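/- Define q_place = max[V/ω_M − ω_M, 0]. If V ≥ ω_M² and the DPP recursion is run with initial condition Q(0) = q_place, then for every slot t, if Q(t) < V/ω_M then p(t) = 0 and μ(t) = 0; consequently Q(t) ≥ q_place for all t. -/

import Mathlib

/-- Deterministic DPP recursion with the place-holder initial condition
`q_place = max (V/ωv M − ωv M) 0`.  If `V ≥ (ωv M)²` and `Q 0 = q_place`, then for
every slot `t`: if `Q t < V/ωv M` then `p t = 0` and `μ t = 0`; consequently
`Q t ≥ q_place` for all `t`. -/
theorem stmt10 (M : ℕ) (ωv : ℕ → ℝ) (hω0 : ωv 0 = 0)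
    (hmono : ∀ i j : ℕ, i < j → j ≤ M → ωv i < ωv j)
    (a w : ℕ → ℝ) (ha : ∀ t, 0 ≤ a t) (hw : ∀ t, ∃ k ≤ M, w t = ωv k)
    (V : ℝ) (hV : ωv M ^ 2 ≤ V)
    (qplace : ℝ) (hqplace : qplace = max (V / ωv M - ωv M) 0)
    (Q p μ : ℕ → ℝ)
    (hQ0 : Q 0 = qplace)
    (hp : ∀ t, p t = if V ≤ Q t * w t then 1 else 0)
    (hμ : ∀ t, μ t = p t * w t)
    (hQ : ∀ t, Q (t + 1) = max (Q t + a t - μ t) 0) :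
    (∀ t, Q t < V / ωv M → p t = 0 ∧ μ t = 0) ∧
      (∀ t, qplace ≤ Q t) := by
  have hle : ∀ k ≤ M, ωv k ≤ ωv M := fun k hk => by
    rcases hk.lt_or_eq with h | rfl
    · exact (hmono k M h le_rfl).le
    · exact le_rfl
  have hW : 0 ≤ ωv M := hω0 ▸ hle 0 M.zero_le
  have hwM : ∀ t, w t ≤ ωv M := fun t => by
    obtain ⟨k, hk, h⟩ := hw t
    exact h ▸ hle k hk
  have hQnn : ∀ t, 0 ≤ Q t := fun t => by
    cases t with
    | zero => rw [hQ0, hqplace]; exact le_max_right _ _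
    | succ t => rw [hQ]; exact le_max_right _ _
  have hidle : ∀ t, Q t < V / ωv M → p t = 0 ∧ μ t = 0 := fun t ht => by
    have hWpos : 0 < ωv M := by
      refine hW.lt_of_ne fun h => ?_
      rw [← h, div_zero] at ht
      exact ht.not_ge (hQnn t)
    have hlt : Q t * w t < V :=
      (mul_le_mul_of_nonneg_left (hwM t) (hQnn t)).trans_lt ((lt_div_iff₀ hWpos).1 ht)
    have hp0 : p t = 0 := by rw [hp, if_neg hlt.not_ge]
    exact ⟨hp0, by rw [hμ, hp0, zero_mul]⟩
  have hμM : ∀ t, μ t ≤ ωv M := fun t => by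
    rw [hμ, hp]
    split_ifs
    · simpa using hwM t
    · simpa using hW
  refine ⟨hidle, fun t => ?_⟩
  induction t with
  | zero => exact hQ0.ge
  | succ t ih =>
    rw [hQ]
    rcases lt_or_ge (Q t) (V / ωv M) with h | h
    · refine le_max_of_le_left ?_
      linarith [(hidle t h).2, ha t]
    · rw [hqplace]
      refine max_le_max_right 0 ?_
      linarith [hμM t, ha t]
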